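/- arXiv:2604.04130 — 2 statements merged into one kernel-verified Lean document; each statement's English description precedes it below -/
import Mathlib

section
/- Assume the standing assumptions, λ⁻¹ > L_g, and let {(X^k, Y^k, Z^k)} be generated by LSALM. Then for every k ≥ 0: F(X^k, Y^k, Z^k) − F(X^{k+1}, Y^{k+1}, Z^{k+1}) ≥ ((2λ⁻¹ + r − L_ρ − L_g)/2)·‖X^k − X^{k+1}‖_F² + ⟨G(X^{k+1}) − εY^k, Y^k − Y^{k+1}⟩ − (ε/2)·‖Y^k − Y^{k+1}‖_F² + ((2−β)r/(2β))·‖Z^k − Z^{k+1}‖_F². -/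
open Matrix

noncomputable section

/-- Frobenius inner product `⟨A,B⟩ = tr(AᵀB)`. -/
def frobInner {m n : ℕ} (A B : Matrix (Fin m) (Fin n) ℝ) : ℝ := (Aᵀ * B).trace

/-- Frobenius norm. -/
def frobNorm {m n : ℕ} (A : Matrix (Fin m) (Fin n) ℝ) : ℝ := Real.sqrt (frobInner A A)

/-- Spectral (operator) norm of a matrix. -/
def specNorm {m n : ℕ} (A : Matrix (Fin m) (Fin n) ℝ) : ℝ :=
  ‖LinearMap.toContinuousLinearMap (Matrix.toEuclideanLin A)‖

/-- `G(X) := XᵀX − Iₙ`. -/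
def Gm {m n : ℕ} (X : Matrix (Fin m) (Fin n) ℝ) : Matrix (Fin n) (Fin n) ℝ := Xᵀ * X - 1

/-- `gradl` is the (Fréchet) gradient of `ℓ` w.r.t. the Frobenius inner product. -/
def IsGradientOf {m n : ℕ} (gradl : Matrix (Fin m) (Fin n) ℝ → Matrix (Fin m) (Fin n) ℝ)
    (ℓ : Matrix (Fin m) (Fin n) ℝ → ℝ) : Prop :=
  ∀ X : Matrix (Fin m) (Fin n) ℝ, ∀ c : ℝ, 0 < c → ∃ δ : ℝ, 0 < δ ∧
    ∀ H : Matrix (Fin m) (Fin n) ℝ, frobNorm H ≤ δ →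
      |ℓ (X + H) - ℓ X - frobInner (gradl X) H| ≤ c * frobNorm H

/-- Augmented Lagrangian `ℒ_ρ(X,Y) = f(X) + ⟨Y, G(X)⟩ + (ρ/2)‖G(X)‖_F²` with `f = ℓ + g`. -/
def Lag {m n : ℕ} (ℓ g : Matrix (Fin m) (Fin n) ℝ → ℝ) (ρ : ℝ)
    (X : Matrix (Fin m) (Fin n) ℝ) (Y : Matrix (Fin n) (Fin n) ℝ) : ℝ :=
  ℓ X + g X + frobInner Y (Gm X) + ρ / 2 * frobNorm (Gm X) ^ 2

/-- `F(X,Y,Z) = ℒ_ρ(X,Y) − (ε/2)‖Y‖_F² + (r/2)‖X−Z‖_F²`. -/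
def Ffun {m n : ℕ} (ℓ g : Matrix (Fin m) (Fin n) ℝ → ℝ) (ρ r ε : ℝ)
    (X : Matrix (Fin m) (Fin n) ℝ) (Y : Matrix (Fin n) (Fin n) ℝ)
    (Z : Matrix (Fin m) (Fin n) ℝ) : ℝ :=
  Lag ℓ g ρ X Y - ε / 2 * frobNorm Y ^ 2 + r / 2 * frobNorm (X - Z) ^ 2

/-- Dual function `d(Y,Z) = min_{X ∈ 𝒳} F(X,Y,Z)`. -/
def dfun {m n : ℕ} (𝒳 : Set (Matrix (Fin m) (Fin n) ℝ))
    (ℓ g : Matrix (Fin m) (Fin n) ℝ → ℝ) (ρ r ε : ℝ)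
    (Y : Matrix (Fin n) (Fin n) ℝ) (Z : Matrix (Fin m) (Fin n) ℝ) : ℝ :=
  sInf ((fun X => Ffun ℓ g ρ r ε X Y Z) '' 𝒳)

/-- Proximal function `p(Z) = max_{Y ∈ 𝒴} d(Y,Z)`. -/
def pfun {m n : ℕ} (𝒳 : Set (Matrix (Fin m) (Fin n) ℝ))
    (𝒴 : Set (Matrix (Fin n) (Fin n) ℝ))
    (ℓ g : Matrix (Fin m) (Fin n) ℝ → ℝ) (ρ r ε : ℝ)
    (Z : Matrix (Fin m) (Fin n) ℝ) : ℝ :=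
  sSup ((fun Y => dfun 𝒳 ℓ g ρ r ε Y Z) '' 𝒴)

/-- Potential function `Φ(X,Y,Z) = F(X,Y,Z) − 2d(Y,Z) + 2p(Z)`. -/
def Phi {m n : ℕ} (𝒳 : Set (Matrix (Fin m) (Fin n) ℝ))
    (𝒴 : Set (Matrix (Fin n) (Fin n) ℝ))
    (ℓ g : Matrix (Fin m) (Fin n) ℝ → ℝ) (ρ r ε : ℝ)
    (X : Matrix (Fin m) (Fin n) ℝ) (Y : Matrix (Fin n) (Fin n) ℝ)
    (Z : Matrix (Fin m) (Fin n) ℝ) : ℝ :=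
  Ffun ℓ g ρ r ε X Y Z - 2 * dfun 𝒳 ℓ g ρ r ε Y Z + 2 * pfun 𝒳 𝒴 ℓ g ρ r ε Z

/-- Linearized augmented Lagrangian `ℒ_{X̄,λ}(X,Y)`. -/
def LinLag {m n : ℕ} (ℓ g : Matrix (Fin m) (Fin n) ℝ → ℝ)
    (gradl : Matrix (Fin m) (Fin n) ℝ → Matrix (Fin m) (Fin n) ℝ) (ρ lam : ℝ)
    (Xb X : Matrix (Fin m) (Fin n) ℝ) (Y : Matrix (Fin n) (Fin n) ℝ) : ℝ :=
  ℓ Xb + frobInner Y (Gm Xb) + ρ / 2 * frobNorm (Gm Xb) ^ 2 + g X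
    + frobInner (gradl Xb) (X - Xb)
    + frobInner ((2 : ℝ) • (Xb * (Y + ρ • Gm Xb))) (X - Xb)
    + 1 / (2 * lam) * frobNorm (X - Xb) ^ 2

theorem frobInner_eq_sum {m n : ℕ} (A B : Matrix (Fin m) (Fin n) ℝ) :
    frobInner A B = ∑ j, ∑ i, A i j * B i j := by
  simp [frobInner, Matrix.trace, Matrix.mul_apply]

theorem frobInner_comm {m n : ℕ} (A B : Matrix (Fin m) (Fin n) ℝ) :
    frobInner A B = frobInner B A := by
  simp only [frobInner_eq_sum, mul_comm]

theorem frobInner_add_left {m n : ℕ} (A B C : Matrix (Fin m) (Fin n) ℝ) :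
    frobInner (A + B) C = frobInner A C + frobInner B C := by
  simp [frobInner, Matrix.add_mul]

theorem frobInner_sub_left {m n : ℕ} (A B C : Matrix (Fin m) (Fin n) ℝ) :
    frobInner (A - B) C = frobInner A C - frobInner B C := by
  simp [frobInner, Matrix.sub_mul]

theorem frobInner_smul_left {m n : ℕ} (c : ℝ) (A B : Matrix (Fin m) (Fin n) ℝ) :
    frobInner (c • A) B = c * frobInner A B := by
  simp [frobInner]

theorem frobInner_add_right {m n : ℕ} (A B C : Matrix (Fin m) (Fin n) ℝ) :
    frobInner A (B + C) = frobInner A B + frobInner A C := by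
  simp [frobInner, Matrix.mul_add]

theorem frobInner_sub_right {m n : ℕ} (A B C : Matrix (Fin m) (Fin n) ℝ) :
    frobInner A (B - C) = frobInner A B - frobInner A C := by
  simp [frobInner, Matrix.mul_sub]

theorem frobInner_smul_right {m n : ℕ} (c : ℝ) (A B : Matrix (Fin m) (Fin n) ℝ) :
    frobInner A (c • B) = c * frobInner A B := by
  simp [frobInner]

theorem frobInner_self_nonneg {m n : ℕ} (A : Matrix (Fin m) (Fin n) ℝ) :
    0 ≤ frobInner A A := by
  rw [frobInner_eq_sum]
  exact Finset.sum_nonneg fun j _ => Finset.sum_nonneg fun i _ => mul_self_nonneg _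

theorem frobNorm_nonneg {m n : ℕ} (A : Matrix (Fin m) (Fin n) ℝ) : 0 ≤ frobNorm A :=
  Real.sqrt_nonneg _

theorem frobNorm_sq {m n : ℕ} (A : Matrix (Fin m) (Fin n) ℝ) :
    frobNorm A ^ 2 = frobInner A A :=
  Real.sq_sqrt (frobInner_self_nonneg A)

theorem frobInner_le_mul {m n : ℕ} (A B : Matrix (Fin m) (Fin n) ℝ) :
    frobInner A B ≤ frobNorm A * frobNorm B := by
  refine (abs_le_of_sq_le_sq' ?_ (mul_nonneg (frobNorm_nonneg A) (frobNorm_nonneg B))).2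
  rw [mul_pow, frobNorm_sq, frobNorm_sq]
  simp only [frobInner_eq_sum, ← Finset.sum_product', ← pow_two]
  exact Finset.sum_mul_sq_le_sq_mul_sq _ _ _

theorem frobNorm_smul {m n : ℕ} (c : ℝ) (A : Matrix (Fin m) (Fin n) ℝ) :
    frobNorm (c • A) = |c| * frobNorm A := by
  rw [frobNorm, frobInner_smul_left, frobInner_smul_right, ← mul_assoc,
    Real.sqrt_mul (mul_self_nonneg c), Real.sqrt_mul_self_eq_abs, frobNorm]

theorem frobNorm_add_le {m n : ℕ} (A B : Matrix (Fin m) (Fin n) ℝ) :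
    frobNorm (A + B) ≤ frobNorm A + frobNorm B := by
  refine (abs_le_of_sq_le_sq' ?_ (add_nonneg (frobNorm_nonneg A) (frobNorm_nonneg B))).2
  rw [add_sq, frobNorm_sq, frobNorm_sq, frobNorm_sq]
  simp only [frobInner_add_left, frobInner_add_right]
  linarith [frobInner_le_mul A B, frobInner_comm A B]

theorem frobNorm_transpose {m n : ℕ} (A : Matrix (Fin m) (Fin n) ℝ) :
    frobNorm Aᵀ = frobNorm A := by
  rw [frobNorm, frobNorm, frobInner, frobInner, Matrix.transpose_transpose, Matrix.trace_mul_comm]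

theorem specNorm_nonneg {m n : ℕ} (A : Matrix (Fin m) (Fin n) ℝ) : 0 ≤ specNorm A :=
  norm_nonneg _

theorem frobNorm_mul_le_specNorm_mul {m n p : ℕ} (A : Matrix (Fin m) (Fin n) ℝ)
    (B : Matrix (Fin n) (Fin p) ℝ) : frobNorm (A * B) ≤ specNorm A * frobNorm B := by
  refine (abs_le_of_sq_le_sq' ?_ (mul_nonneg (specNorm_nonneg A) (frobNorm_nonneg B))).2
  rw [mul_pow, frobNorm_sq, frobNorm_sq, frobInner_eq_sum, frobInner_eq_sum, Finset.mul_sum]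
  refine Finset.sum_le_sum fun j _ => ?_
  have h := (LinearMap.toContinuousLinearMap (Matrix.toEuclideanLin A)).le_opNorm
    (WithLp.toLp 2 fun i => B i j)
  have h2 := pow_le_pow_left₀ (norm_nonneg _) h 2
  rw [mul_pow, EuclideanSpace.norm_sq_eq, EuclideanSpace.norm_sq_eq] at h2
  simpa [specNorm, pow_two, Matrix.mul_apply, Matrix.toLpLin_apply, Matrix.mulVec, dotProduct]
    using h2

theorem frobNorm_transpose_mul_le_specNorm_mul {m n p : ℕ} (A : Matrix (Fin m) (Fin n) ℝ)
    (B : Matrix (Fin m) (Fin p) ℝ) : frobNorm (Aᵀ * B) ≤ specNorm A * frobNorm B := by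
  have h1 : frobNorm (Aᵀ * B) ^ 2 = frobInner B (A * (Aᵀ * B)) := by
    rw [frobNorm_sq, frobInner, frobInner, Matrix.transpose_mul, Matrix.transpose_transpose,
      Matrix.mul_assoc]
  have h2 := frobInner_le_mul B (A * (Aᵀ * B))
  have h3 := mul_le_mul_of_nonneg_left (frobNorm_mul_le_specNorm_mul A (Aᵀ * B))
    (frobNorm_nonneg B)
  by_contra! h
  have h0 : 0 < frobNorm (Aᵀ * B) :=
    (mul_nonneg (specNorm_nonneg A) (frobNorm_nonneg B)).trans_lt h
  nlinarith [mul_lt_mul_of_pos_right h h0]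

theorem frobNorm_transpose_mul_self_le {m n : ℕ} (D : Matrix (Fin m) (Fin n) ℝ) :
    frobNorm (Dᵀ * D) ≤ frobNorm D ^ 2 := by
  refine (abs_le_of_sq_le_sq' ?_ (sq_nonneg _)).2
  rw [frobNorm_sq, frobNorm_sq, frobInner_eq_sum, frobInner_eq_sum, pow_two, Finset.sum_mul_sum]
  refine Finset.sum_le_sum fun i _ => Finset.sum_le_sum fun j _ => ?_
  simp only [Matrix.mul_apply, Matrix.transpose_apply, ← pow_two]
  rw [mul_comm]
  exact Finset.sum_mul_sq_le_sq_mul_sq _ _ _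

/-- The gradient gives the derivative along lines. -/
theorem IsGradientOf.hasDerivAt_line {m n : ℕ}
    {gradl : Matrix (Fin m) (Fin n) ℝ → Matrix (Fin m) (Fin n) ℝ}
    {ℓ : Matrix (Fin m) (Fin n) ℝ → ℝ} (h : IsGradientOf gradl ℓ)
    (X D : Matrix (Fin m) (Fin n) ℝ) (t : ℝ) :
    HasDerivAt (fun s : ℝ => ℓ (X + s • D)) (frobInner (gradl (X + t • D)) D) t := by
  rw [hasDerivAt_iff_isLittleO, Asymptotics.isLittleO_iff]
  intro c hc
  have hD : 0 < frobNorm D + 1 := by linarith [frobNorm_nonneg D]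
  obtain ⟨δ, hδ, H⟩ := h (X + t • D) (c / (frobNorm D + 1)) (div_pos hc hD)
  filter_upwards [Metric.ball_mem_nhds t (div_pos hδ hD)] with s hs
  rw [Metric.mem_ball, Real.dist_eq, lt_div_iff₀ hD] at hs
  have hle : frobNorm ((s - t) • D) ≤ δ := by
    rw [frobNorm_smul]
    nlinarith [abs_nonneg (s - t)]
  have h1 := H _ hle
  have e : X + t • D + (s - t) • D = X + s • D := by rw [sub_smul]; abel
  rw [e, frobInner_smul_right, frobNorm_smul] at h1
  simp only [Real.norm_eq_abs, smul_eq_mul]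
  refine h1.trans ?_
  rw [div_mul_eq_mul_div, div_le_iff₀ hD]
  nlinarith [mul_nonneg hc.le (abs_nonneg (s - t))]

/-- Descent lemma: quadratic upper bound for a function with Lipschitz gradient. -/
theorem IsGradientOf.le_add_quadratic {m n : ℕ}
    {gradl : Matrix (Fin m) (Fin n) ℝ → Matrix (Fin m) (Fin n) ℝ}
    {ℓ : Matrix (Fin m) (Fin n) ℝ → ℝ} {S : Set (Matrix (Fin m) (Fin n) ℝ)} {L : ℝ}
    (h : IsGradientOf gradl ℓ) (hS : Convex ℝ S)
    (hL : ∀ X ∈ S, ∀ X' ∈ S, frobNorm (gradl X - gradl X') ≤ L * frobNorm (X - X'))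
    {X X' : Matrix (Fin m) (Fin n) ℝ} (hX : X ∈ S) (hX' : X' ∈ S) :
    ℓ X' ≤ ℓ X + frobInner (gradl X) (X' - X) + L / 2 * frobNorm (X' - X) ^ 2 := by
  set D := X' - X with hD
  have hder (t : ℝ) : HasDerivAt
      (fun s : ℝ => ℓ (X + s • D) - s * frobInner (gradl X) D - s ^ 2 * (L / 2 * frobNorm D ^ 2))
      (frobInner (gradl (X + t • D)) D - 1 * frobInner (gradl X) D
        - (2 * t) * (L / 2 * frobNorm D ^ 2)) t := by
    have h2 := (hasDerivAt_pow 2 t).mul_const (L / 2 * frobNorm D ^ 2)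
    simp only [Nat.cast_ofNat, Nat.add_one_sub_one, pow_one] at h2
    exact ((h.hasDerivAt_line X D t).sub ((hasDerivAt_id t).mul_const _)).sub h2
  have hanti := antitoneOn_of_deriv_nonpos (convex_Icc (0 : ℝ) 1)
    (fun t _ => (hder t).continuousAt.continuousWithinAt)
    (fun t _ => (hder t).differentiableAt.differentiableWithinAt)
    (fun t ht => by
      rw [interior_Icc] at ht
      rw [(hder t).deriv]
      have hmem : X + t • D ∈ S := hS.add_smul_sub_mem hX hX' ⟨ht.1.le, ht.2.le⟩
      have h1 := hL _ hmem _ hX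
      rw [add_sub_cancel_left, frobNorm_smul, abs_of_pos ht.1] at h1
      have h2 := frobInner_le_mul (gradl (X + t • D) - gradl X) D
      rw [frobInner_sub_left] at h2
      nlinarith [mul_le_mul_of_nonneg_right h1 (frobNorm_nonneg D)])
  have := hanti (Set.left_mem_Icc.2 zero_le_one) (Set.right_mem_Icc.2 zero_le_one) zero_le_one
  simp only [one_smul, zero_smul, add_zero, hD, add_sub_cancel] at this
  rw [← hD] at this
  linarith

theorem frobInner_transpose_mul {m n p : ℕ} (X : Matrix (Fin m) (Fin n) ℝ)
    (D : Matrix (Fin m) (Fin p) ℝ) (Y : Matrix (Fin n) (Fin p) ℝ) :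
    frobInner Y (Xᵀ * D) = frobInner (X * Y) D := by
  rw [frobInner, frobInner, Matrix.transpose_mul, Matrix.mul_assoc]

theorem frobInner_symm_transpose {n : ℕ} (A : Matrix (Fin n) (Fin n) ℝ)
    {Y : Matrix (Fin n) (Fin n) ℝ} (hY : Y.IsSymm) :
    frobInner Y Aᵀ = frobInner Y A := by
  rw [frobInner, frobInner, ← Matrix.trace_transpose, Matrix.transpose_mul,
    Matrix.transpose_transpose, Matrix.transpose_transpose, Matrix.trace_mul_comm, hY.eq]

theorem isSymm_Gm {m n : ℕ} (X : Matrix (Fin m) (Fin n) ℝ) : (Gm X).IsSymm := by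
  simp [Gm, Matrix.IsSymm, Matrix.transpose_mul]

theorem Gm_sub_Gm {m n : ℕ} (X X' : Matrix (Fin m) (Fin n) ℝ) :
    Gm X' - Gm X = Xᵀ * (X' - X) + (Xᵀ * (X' - X))ᵀ + (X' - X)ᵀ * (X' - X) := by
  simp only [Gm, Matrix.transpose_mul, Matrix.transpose_transpose, Matrix.transpose_sub,
    Matrix.mul_sub, Matrix.sub_mul]
  abel

theorem frobInner_symm_Gm {m n : ℕ} (X X' : Matrix (Fin m) (Fin n) ℝ)
    {Y : Matrix (Fin n) (Fin n) ℝ} (hY : Y.IsSymm) :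
    frobInner Y (Gm X') = frobInner Y (Gm X) + 2 * frobInner (X * Y) (X' - X)
      + frobInner Y ((X' - X)ᵀ * (X' - X)) := by
  have h : frobInner Y (Gm X' - Gm X) = 2 * frobInner (X * Y) (X' - X)
      + frobInner Y ((X' - X)ᵀ * (X' - X)) := by
    rw [Gm_sub_Gm, frobInner_add_right, frobInner_add_right, frobInner_symm_transpose _ hY,
      frobInner_transpose_mul]
    ring
  rw [frobInner_sub_right] at h
  linarith

/-- Quadratic upper bound for the multiplier term. -/
theorem frobInner_Gm_le {m n : ℕ} (X X' : Matrix (Fin m) (Fin n) ℝ)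
    {Y : Matrix (Fin n) (Fin n) ℝ} {R : ℝ} (hY : Y.IsSymm) (hR : frobNorm Y ≤ R) :
    frobInner Y (Gm X') ≤ frobInner Y (Gm X) + 2 * frobInner (X * Y) (X' - X)
      + R * frobNorm (X' - X) ^ 2 := by
  rw [frobInner_symm_Gm X X' hY]
  have h1 := frobInner_le_mul Y ((X' - X)ᵀ * (X' - X))
  have h2 := mul_le_mul hR (frobNorm_transpose_mul_self_le (X' - X)) (frobNorm_nonneg _)
    ((frobNorm_nonneg Y).trans hR)
  linarith

/-- Quadratic upper bound for the penalty term. -/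
theorem frobNorm_Gm_sq_le {m n : ℕ} {X X' : Matrix (Fin m) (Fin n) ℝ} {R : ℝ}
    (hX : specNorm X ≤ R) (hX' : specNorm X' ≤ R) :
    frobNorm (Gm X') ^ 2 ≤ frobNorm (Gm X) ^ 2 + 4 * frobInner (X * Gm X) (X' - X)
      + (6 * R ^ 2 + 2) * frobNorm (X' - X) ^ 2 := by
  have hR : 0 ≤ R := (specNorm_nonneg X).trans hX
  have h1 := frobInner_symm_Gm X X' (isSymm_Gm X)
  set D := X' - X with hD
  have hd := frobNorm_nonneg D
  have h2 : frobNorm (Gm X') ^ 2 = frobNorm (Gm X) ^ 2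
      + 2 * (frobInner (Gm X) (Gm X') - frobInner (Gm X) (Gm X))
      + frobNorm (Gm X' - Gm X) ^ 2 := by
    simp only [frobNorm_sq, frobInner_sub_left, frobInner_sub_right]
    linarith [frobInner_comm (Gm X) (Gm X')]
  have h3 : frobInner (Gm X) (Dᵀ * D) = frobNorm (X * Dᵀ) ^ 2 - frobNorm D ^ 2 := by
    rw [frobNorm_sq, frobNorm_sq, Gm, frobInner_sub_left]
    congr 1
    · simp only [frobInner, Matrix.transpose_mul, Matrix.transpose_transpose]
      rw [← Matrix.mul_assoc, Matrix.trace_mul_comm, Matrix.mul_assoc, Matrix.mul_assoc]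
    · simp [frobInner]
  have h4 : frobNorm (X * Dᵀ) ≤ R * frobNorm D := by
    refine (frobNorm_mul_le_specNorm_mul X Dᵀ).trans ?_
    rw [frobNorm_transpose]
    exact mul_le_mul_of_nonneg_right hX hd
  have h5 : frobNorm (Gm X' - Gm X) ≤ 2 * (R * frobNorm D) := by
    have e : Gm X' - Gm X = X'ᵀ * D + (Xᵀ * D)ᵀ := by
      simp only [hD, Gm, Matrix.transpose_mul, Matrix.transpose_transpose, Matrix.transpose_sub,
        Matrix.mul_sub]
      abel
    rw [e]
    have h6 := frobNorm_add_le (X'ᵀ * D) (Xᵀ * D)ᵀ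
    rw [frobNorm_transpose] at h6
    linarith [frobNorm_transpose_mul_le_specNorm_mul X' D,
      frobNorm_transpose_mul_le_specNorm_mul X D,
      mul_le_mul_of_nonneg_right hX hd, mul_le_mul_of_nonneg_right hX' hd]
  have h7 := pow_le_pow_left₀ (frobNorm_nonneg _) h4 2
  have h8 := pow_le_pow_left₀ (frobNorm_nonneg _) h5 2
  nlinarith [sq_nonneg (frobNorm D)]

theorem frobNorm_convexCombo_sub_sq {m n : ℕ} (A B C : Matrix (Fin m) (Fin n) ℝ) (t : ℝ) :
    frobNorm ((1 - t) • A + t • B - C) ^ 2 = (1 - t) * frobNorm (A - C) ^ 2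
      + t * frobNorm (B - C) ^ 2 - t * (1 - t) * frobNorm (B - A) ^ 2 := by
  simp only [frobNorm_sq, frobInner_sub_left, frobInner_sub_right, frobInner_add_left,
    frobInner_add_right, frobInner_smul_left, frobInner_smul_right, frobInner_comm B A,
    frobInner_comm C A, frobInner_comm C B]
  ring

/-- Quadratic growth of a weakly convex function plus a quadratic at a minimizer. -/
theorem quadratic_growth_of_weaklyConvex {m n : ℕ} {S : Set (Matrix (Fin m) (Fin n) ℝ)}
    {g : Matrix (Fin m) (Fin n) ℝ → ℝ} {w a b : ℝ} {V P Q X₀ X : Matrix (Fin m) (Fin n) ℝ}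
    (hg : ConvexOn ℝ S (fun X => g X + w / 2 * frobNorm X ^ 2)) (hX₀ : X₀ ∈ S) (hX : X ∈ S)
    (hmin : ∀ X' ∈ S,
      g X₀ + frobInner V (X₀ - P) + a / 2 * frobNorm (X₀ - P) ^ 2 + b / 2 * frobNorm (X₀ - Q) ^ 2
        ≤ g X' + frobInner V (X' - P) + a / 2 * frobNorm (X' - P) ^ 2
          + b / 2 * frobNorm (X' - Q) ^ 2) :
    g X₀ + frobInner V (X₀ - P) + a / 2 * frobNorm (X₀ - P) ^ 2 + b / 2 * frobNorm (X₀ - Q) ^ 2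
        + (a + b - w) / 2 * frobNorm (X - X₀) ^ 2
      ≤ g X + frobInner V (X - P) + a / 2 * frobNorm (X - P) ^ 2
        + b / 2 * frobNorm (X - Q) ^ 2 := by
  set ψ : Matrix (Fin m) (Fin n) ℝ → ℝ := fun X => g X + frobInner V (X - P)
    + a / 2 * frobNorm (X - P) ^ 2 + b / 2 * frobNorm (X - Q) ^ 2 with hψ
  have key : ∀ t ∈ Set.Ioo (0 : ℝ) 1,
      ψ X₀ + (a + b - w) / 2 * frobNorm (X - X₀) ^ 2 * (1 - t) ≤ ψ X := by
    intro t ht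
    have h1 := hmin _ (hg.1 hX₀ hX (sub_nonneg.2 ht.2.le) ht.1.le (sub_add_cancel 1 t))
    have h2 := hg.2 hX₀ hX (sub_nonneg.2 ht.2.le) ht.1.le (sub_add_cancel 1 t)
    have h3 := frobNorm_convexCombo_sub_sq X₀ X 0 t
    simp only [sub_zero] at h3
    have h4 : frobInner V ((1 - t) • X₀ + t • X - P)
        = (1 - t) * frobInner V (X₀ - P) + t * frobInner V (X - P) := by
      simp only [frobInner_sub_right, frobInner_add_right, frobInner_smul_right]
      ring
    simp only [smul_eq_mul, h3] at h2
    rw [frobNorm_convexCombo_sub_sq, frobNorm_convexCombo_sub_sq, h4] at h1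
    refine le_of_mul_le_mul_left ?_ ht.1
    simp only [hψ]
    linear_combination h1 + h2
  have hlim : Filter.Tendsto
      (fun t : ℝ => ψ X₀ + (a + b - w) / 2 * frobNorm (X - X₀) ^ 2 * (1 - t))
      (nhdsWithin 0 (Set.Ioi 0))
      (nhds (ψ X₀ + (a + b - w) / 2 * frobNorm (X - X₀) ^ 2 * (1 - 0))) :=
    (Continuous.tendsto (by fun_prop) 0).mono_left nhdsWithin_le_nhds
  have := le_of_tendsto hlim (Filter.eventually_of_mem (Ioo_mem_nhdsGT one_pos) key)
  simpa using this

/-- Primal descent inequality along the LSALM iterates. -/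
theorem primal_descent {m n : ℕ} (hmn : n ≤ m)
    (𝒳 : Set (Matrix (Fin m) (Fin n) ℝ)) (𝒴 : Set (Matrix (Fin n) (Fin n) ℝ))
    (ℓ g : Matrix (Fin m) (Fin n) ℝ → ℝ)
    (gradl : Matrix (Fin m) (Fin n) ℝ → Matrix (Fin m) (Fin n) ℝ)
    (Lℓ Lg ρ RX RY r ε lam α β μρ Lρ : ℝ)
    (h𝒳conv : Convex ℝ 𝒳) (h𝒳cpt : IsCompact 𝒳)
    (h𝒳R : ∀ X ∈ 𝒳, specNorm X ≤ RX)
    (hgrad : IsGradientOf gradl ℓ) (hgradcont : Continuous gradl)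
    (hgradLip : ∀ X ∈ 𝒳, ∀ X' ∈ 𝒳, frobNorm (gradl X - gradl X') ≤ Lℓ * frobNorm (X - X'))
    (hgwc : ConvexOn ℝ 𝒳 (fun X => g X + Lg / 2 * frobNorm X ^ 2))
    (h𝒴symm : ∀ Y ∈ 𝒴, Y.IsSymm) (h𝒴conv : Convex ℝ 𝒴) (h𝒴cpt : IsCompact 𝒴)
    (h𝒴zero : (0 : Matrix (Fin n) (Fin n) ℝ) ∈ 𝒴)
    (h𝒴R : ∀ Y ∈ 𝒴, frobNorm Y ≤ RY)
    (hρ : 0 ≤ ρ) (hε : 0 < ε) (hlam : 0 < lam) (hα : 0 < α) (hβ0 : 0 < β) (hβ1 : β < 1)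
    (hμρ : μρ = (Lℓ + Lg) + 2 * RY + 2 * ρ)
    (hLρ : Lρ = Lℓ + 2 * RY + 6 * ρ * RX ^ 2 + 2 * ρ)
    (hr : μρ < r) (hlamg : Lg < lam⁻¹)
    (Xm : Matrix (Fin n) (Fin n) ℝ → Matrix (Fin m) (Fin n) ℝ → Matrix (Fin m) (Fin n) ℝ)
    (hXm : ∀ Y Z, Xm Y Z ∈ 𝒳 ∧ ∀ X' ∈ 𝒳, Ffun ℓ g ρ r ε (Xm Y Z) Y Z ≤ Ffun ℓ g ρ r ε X' Y Z)
    (proj : Matrix (Fin n) (Fin n) ℝ → Matrix (Fin n) (Fin n) ℝ)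
    (hproj : ∀ W, proj W ∈ 𝒴 ∧ ∀ Y' ∈ 𝒴, frobNorm (W - proj W) ≤ frobNorm (W - Y'))
    (XS ZS : ℕ → Matrix (Fin m) (Fin n) ℝ) (YS : ℕ → Matrix (Fin n) (Fin n) ℝ)
    (hX0 : XS 0 ∈ 𝒳) (hX0feas : (XS 0)ᵀ * XS 0 = 1) (hY0 : YS 0 = 0) (hZ0 : ZS 0 = XS 0)
    (hXit : ∀ k : ℕ, XS (k + 1) ∈ 𝒳 ∧ ∀ X' ∈ 𝒳,
      LinLag ℓ g gradl ρ lam (XS k) (XS (k + 1)) (YS k)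
          + r / 2 * frobNorm (XS (k + 1) - ZS k) ^ 2
        ≤ LinLag ℓ g gradl ρ lam (XS k) X' (YS k) + r / 2 * frobNorm (X' - ZS k) ^ 2)
    (hZit : ∀ k : ℕ, ZS (k + 1) = ZS k + β • (XS (k + 1) - ZS k))
    (hYit : ∀ k : ℕ, YS (k + 1) = proj (YS k + α • (Gm (XS (k + 1)) - ε • YS k))) :
    ∀ k : ℕ,
      Ffun ℓ g ρ r ε (XS k) (YS k) (ZS k)
          - Ffun ℓ g ρ r ε (XS (k + 1)) (YS (k + 1)) (ZS (k + 1))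
        ≥ (2 * lam⁻¹ + r - Lρ - Lg) / 2 * frobNorm (XS k - XS (k + 1)) ^ 2
          + frobInner (Gm (XS (k + 1)) - ε • YS k) (YS k - YS (k + 1))
          - ε / 2 * frobNorm (YS k - YS (k + 1)) ^ 2
          + (2 - β) * r / (2 * β) * frobNorm (ZS k - ZS (k + 1)) ^ 2 := by
  intro k
  have hXmem : ∀ k, XS k ∈ 𝒳
    | 0 => hX0
    | k + 1 => (hXit k).1
  have hYmem : ∀ k, YS k ∈ 𝒴
    | 0 => hY0 ▸ h𝒴zero
    | k + 1 => hYit k ▸ (hproj _).1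
  have hX := hXmem k
  have hX' := hXmem (k + 1)
  have hY := hYmem k
  have hmin := (hXit k).2
  have hZ := hZit k
  generalize XS (k + 1) = X' at *
  generalize YS (k + 1) = Y'
  generalize ZS (k + 1) = Z' at *
  generalize XS k = X at *
  generalize YS k = Y at *
  generalize ZS k = Z at *
  have hl := hgrad.le_add_quadratic h𝒳conv hgradLip hX hX'
  have hm := frobInner_Gm_le X X' (h𝒴symm Y hY) (h𝒴R Y hY)
  have hp := mul_le_mul_of_nonneg_left
    (frobNorm_Gm_sq_le (h𝒳R X hX) (h𝒳R X' hX')) (div_nonneg hρ zero_le_two)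
  have hlin (W : Matrix (Fin m) (Fin n) ℝ) : frobInner ((2 : ℝ) • (X * (Y + ρ • Gm X))) W
      = 2 * frobInner (X * Y) W + 2 * ρ * frobInner (X * Gm X) W := by
    rw [Matrix.mul_add, Matrix.mul_smul, frobInner_smul_left, frobInner_add_left,
      frobInner_smul_left]
    ring
  have hlam2 : 1 / (2 * lam) = lam⁻¹ / 2 := by
    field_simp
  have hgrow := quadratic_growth_of_weaklyConvex (a := lam⁻¹) (b := r) (P := X) (Q := Z)
    (V := gradl X + (2 : ℝ) • (X * (Y + ρ • Gm X))) hgwc hX' hX (fun W hW => by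
      have := hmin W hW
      simp only [LinLag, hlam2] at this
      simp only [frobInner_add_left]
      linarith)
  have hXX : frobInner (gradl X + (2 : ℝ) • (X * (Y + ρ • Gm X))) (X - X) = 0 := by
    simp [frobInner]
  have hXX2 : frobNorm (X - X) ^ 2 = 0 := by
    rw [frobNorm_sq]
    simp [frobInner]
  rw [hXX, hXX2, frobInner_add_left, hlin] at hgrow
  have hsymm : frobNorm (X' - X) ^ 2 = frobNorm (X - X') ^ 2 := by
    rw [← neg_sub X X', ← neg_one_smul ℝ (X - X'), frobNorm_smul]
    simp
  rw [hsymm] at hl hm hp hgrow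
  have hZ1 : frobNorm (X' - Z') ^ 2 = (1 - β) ^ 2 * frobNorm (X' - Z) ^ 2 := by
    have e : X' - Z' = (1 - β) • (X' - Z) := by
      rw [hZ, sub_smul, one_smul]
      abel
    rw [e, frobNorm_smul, mul_pow, sq_abs]
  have hZ2 : (2 - β) * r / (2 * β) * frobNorm (Z - Z') ^ 2
      = r / 2 * (1 - (1 - β) ^ 2) * frobNorm (X' - Z) ^ 2 := by
    have e : Z - Z' = (-β) • (X' - Z) := by
      rw [hZ, neg_smul]
      abel
    rw [e, frobNorm_smul, mul_pow, sq_abs]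
    field_simp
    ring
  have hYY : frobInner (Gm X' - ε • Y) (Y - Y') - ε / 2 * frobNorm (Y - Y') ^ 2
      = frobInner Y (Gm X') - frobInner Y' (Gm X') - ε / 2 * frobNorm Y ^ 2
        + ε / 2 * frobNorm Y' ^ 2 - ε * frobNorm (Y - Y') ^ 2 := by
    simp only [frobNorm_sq, frobInner_sub_left, frobInner_sub_right, frobInner_smul_left,
      frobInner_comm Y' Y, frobInner_comm (Gm X')]
    ring
  have hεY := mul_nonneg hε.le (sq_nonneg (frobNorm (Y - Y')))
  rw [hZ2, add_sub_assoc, hYY]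
  simp only [Ffun, Lag, hZ1, hLρ]
  linarith

end
end

section
/- Assume the standing assumptions. Then for all Z, Z′ ∈ ℝ^{m×n} and any maximizer Y(Z′) of d(·, Z′) over 𝒴: p(Z) − p(Z′) ≥ (r/2)·⟨Z′ − Z, 2X(Y(Z′), Z) − Z − Z′⟩. -/
open Matrix

noncomputable section

theorem frobNorm_sub_sq_sub_frobNorm_sub_sq {m n : ℕ} (X Z Z' : Matrix (Fin m) (Fin n) ℝ) :
    frobNorm (X - Z) ^ 2 - frobNorm (X - Z') ^ 2
      = frobInner (Z' - Z) ((2 : ℝ) • X - Z - Z') := by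
  have hZX := frobInner_comm Z X
  have hZX' := frobInner_comm Z' X
  have hZZ := frobInner_comm Z Z'
  simp only [frobNorm_sq]
  simp only [frobInner, transpose_sub, Matrix.sub_mul, Matrix.mul_sub, trace_sub,
    Matrix.mul_smul, trace_smul, smul_eq_mul] at *
  linarith

theorem continuous_Ffun_dual {m n : ℕ} (ℓ g : Matrix (Fin m) (Fin n) ℝ → ℝ) (ρ r ε : ℝ)
    (X Z : Matrix (Fin m) (Fin n) ℝ) : Continuous fun Y => Ffun ℓ g ρ r ε X Y Z := by
  unfold Ffun Lag frobNorm frobInner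
  fun_prop

theorem dfun_eq_of_isMinOn {m n : ℕ} {𝒳 : Set (Matrix (Fin m) (Fin n) ℝ)}
    {ℓ g : Matrix (Fin m) (Fin n) ℝ → ℝ} {ρ r ε : ℝ}
    {X : Matrix (Fin m) (Fin n) ℝ} {Y : Matrix (Fin n) (Fin n) ℝ} {Z : Matrix (Fin m) (Fin n) ℝ}
    (hX : X ∈ 𝒳) (hmin : IsMinOn (fun X => Ffun ℓ g ρ r ε X Y Z) 𝒳 X) :
    dfun 𝒳 ℓ g ρ r ε Y Z = Ffun ℓ g ρ r ε X Y Z :=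
  IsLeast.csInf_eq ⟨Set.mem_image_of_mem _ hX, Set.forall_mem_image.2 fun _ h => hmin h⟩

/-- Proximal descent inequality for the proximal function `p`. -/
theorem proximal_descent {m n : ℕ} (hmn : n ≤ m)
    (𝒳 : Set (Matrix (Fin m) (Fin n) ℝ)) (𝒴 : Set (Matrix (Fin n) (Fin n) ℝ))
    (ℓ g : Matrix (Fin m) (Fin n) ℝ → ℝ)
    (gradl : Matrix (Fin m) (Fin n) ℝ → Matrix (Fin m) (Fin n) ℝ)
    (Lℓ Lg ρ RX RY r ε μρ : ℝ)
    (h𝒳conv : Convex ℝ 𝒳) (h𝒳cpt : IsCompact 𝒳)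
    (h𝒳R : ∀ X ∈ 𝒳, specNorm X ≤ RX)
    (hgrad : IsGradientOf gradl ℓ) (hgradcont : Continuous gradl)
    (hgradLip : ∀ X ∈ 𝒳, ∀ X' ∈ 𝒳, frobNorm (gradl X - gradl X') ≤ Lℓ * frobNorm (X - X'))
    (hgwc : ConvexOn ℝ 𝒳 (fun X => g X + Lg / 2 * frobNorm X ^ 2))
    (h𝒴symm : ∀ Y ∈ 𝒴, Y.IsSymm) (h𝒴conv : Convex ℝ 𝒴) (h𝒴cpt : IsCompact 𝒴)
    (h𝒴zero : (0 : Matrix (Fin n) (Fin n) ℝ) ∈ 𝒴)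
    (h𝒴R : ∀ Y ∈ 𝒴, frobNorm Y ≤ RY)
    (hρ : 0 ≤ ρ) (hε : 0 < ε)
    (hμρ : μρ = (Lℓ + Lg) + 2 * RY + 2 * ρ) (hr : μρ < r)
    (Xm : Matrix (Fin n) (Fin n) ℝ → Matrix (Fin m) (Fin n) ℝ → Matrix (Fin m) (Fin n) ℝ)
    (hXm : ∀ Y Z, Xm Y Z ∈ 𝒳 ∧ ∀ X' ∈ 𝒳, Ffun ℓ g ρ r ε (Xm Y Z) Y Z ≤ Ffun ℓ g ρ r ε X' Y Z) :
    ∀ Z Z' : Matrix (Fin m) (Fin n) ℝ,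
      ∀ Ymax ∈ 𝒴, (∀ Y' ∈ 𝒴, dfun 𝒳 ℓ g ρ r ε Y' Z' ≤ dfun 𝒳 ℓ g ρ r ε Ymax Z') →
        pfun 𝒳 𝒴 ℓ g ρ r ε Z - pfun 𝒳 𝒴 ℓ g ρ r ε Z'
          ≥ r / 2 * frobInner (Z' - Z) ((2 : ℝ) • Xm Ymax Z - Z - Z') := by
  intro Z Z' Ymax hYmax hmax
  have hd : ∀ Y Z, dfun 𝒳 ℓ g ρ r ε Y Z = Ffun ℓ g ρ r ε (Xm Y Z) Y Z := fun Y Z =>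
    dfun_eq_of_isMinOn (hXm Y Z).1 (hXm Y Z).2
  have hd_le : ∀ X ∈ 𝒳, ∀ Y Z, dfun 𝒳 ℓ g ρ r ε Y Z ≤ Ffun ℓ g ρ r ε X Y Z := fun X hX Y Z =>
    (hd Y Z).trans_le ((hXm Y Z).2 X hX)
  have hX := (hXm Ymax Z).1
  obtain ⟨b, hb⟩ := h𝒴cpt.bddAbove_image
    (continuous_Ffun_dual ℓ g ρ r ε (Xm Ymax Z) Z).continuousOn
  have hbdd : BddAbove ((fun Y => dfun 𝒳 ℓ g ρ r ε Y Z) '' 𝒴) :=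
    ⟨b, Set.forall_mem_image.2 fun Y hY =>
      (hd_le _ hX Y Z).trans (hb (Set.mem_image_of_mem _ hY))⟩
  have hp : Ffun ℓ g ρ r ε (Xm Ymax Z) Ymax Z ≤ pfun 𝒳 𝒴 ℓ g ρ r ε Z :=
    (hd Ymax Z).symm.trans_le (le_csSup hbdd (Set.mem_image_of_mem _ hYmax))
  have hp' : pfun 𝒳 𝒴 ℓ g ρ r ε Z' = dfun 𝒳 ℓ g ρ r ε Ymax Z' :=
    IsGreatest.csSup_eq ⟨Set.mem_image_of_mem _ hYmax, Set.forall_mem_image.2 hmax⟩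
  have hle := hd_le _ hX Ymax Z'
  rw [← frobNorm_sub_sq_sub_frobNorm_sub_sq, hp']
  unfold Ffun at hp hle
  linarith

end
end
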